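/- Let 𝒳_n be the i.i.d. Gaussian spike prior: the law of a random vector in ℝⁿ with independent N(0, 1/n) coordinates. For every λ with 0 ≤ λ < 1, the spiked Gaussian Wigner sequence GWig_n(λ, 𝒳) is contiguous to the unspiked sequence GWig_n(0). -/

import Mathlib

open MeasureTheory Filter Topology ProbabilityTheory
open scoped ENNReal NNReal

/-- A sequence of probability measures `P n` is contiguous to `Q n` if for every
sequence of measurable events `A n`, `Q n (A n) → 0` implies `P n (A n) → 0`. -/
def Contiguous {Ω : ℕ → Type*} [∀ n, MeasurableSpace (Ω n)]
    (P Q : (n : ℕ) → Measure (Ω n)) : Prop :=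
  ∀ A : (n : ℕ) → Set (Ω n), (∀ n, MeasurableSet (A n)) →
    Tendsto (fun n => Q n (A n)) atTop (𝓝 0) →
    Tendsto (fun n => P n (A n)) atTop (𝓝 0)

/-- The unspiked Gaussian Wigner measure `GWig_n(0)`. -/
noncomputable def gwigUnspiked (n : ℕ) : Measure (Fin n → Fin n → ℝ) :=
  (Measure.pi fun _ : Fin n × Fin n => gaussianReal 0 (1 / (2 * (n : ℝ≥0)))).map
    fun W i j => W (i, j) + W (j, i)

/-- The spiked Gaussian Wigner measure `GWig_n(λ, 𝒳)`: mixture over `x ~ 𝒳` of the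
pushforward of `GWig_n(0)` under `Y ↦ λ x xᵀ + Y`. -/
noncomputable def gwigSpiked (n : ℕ) (lam : ℝ) (prior : Measure (Fin n → ℝ)) :
    Measure (Fin n → Fin n → ℝ) :=
  prior.bind fun x => (gwigUnspiked n).map fun Y i j => lam * (x i * x j) + Y i j

/-- The i.i.d. Gaussian spike prior: the coordinates of `x ∈ ℝⁿ` are independent
`N(0, 1/n)`. -/
noncomputable def gaussPrior (n : ℕ) : Measure (Fin n → ℝ) :=
  Measure.pi fun _ : Fin n => gaussianReal 0 ((n : ℝ≥0))⁻¹

theorem lintegral_pi_prod {ι : Type*} [Fintype ι] (μ : ι → Measure ℝ)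
    [∀ i, IsProbabilityMeasure (μ i)] {f : ι → ℝ → ℝ≥0∞} (hf : ∀ i, Measurable (f i)) :
    ∫⁻ x, ∏ i, f i (x i) ∂Measure.pi μ = ∏ i, ∫⁻ t, f i t ∂μ i := by
  have hind : iIndepFun (fun i (x : ι → ℝ) => f i (x i)) (Measure.pi μ) :=
    iIndepFun_pi fun i => (hf i).aemeasurable
  rw [lintegral_prod_eq_prod_lintegral_of_indepFun Finset.univ _ hind
    fun i => (hf i).comp (measurable_pi_apply i)]
  refine Finset.prod_congr rfl fun i _ => ?_
  exact (measurePreserving_eval μ i).lintegral_comp (hf i)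

theorem ofReal_exp_sum {ι : Type*} [Fintype ι] (a : ι → ℝ) :
    ENNReal.ofReal (Real.exp (∑ i, a i)) = ∏ i, ENNReal.ofReal (Real.exp (a i)) := by
  rw [Real.exp_sum, ENNReal.ofReal_prod_of_nonneg fun i _ => (Real.exp_pos _).le]

theorem lintegral_exp_mul_gaussianReal (v : ℝ≥0) (a : ℝ) :
    ∫⁻ t, ENNReal.ofReal (Real.exp (a * t)) ∂gaussianReal 0 v
      = ENNReal.ofReal (Real.exp (v * a ^ 2 / 2)) := by
  rw [← ofReal_integral_eq_lintegral_ofReal (integrable_exp_mul_gaussianReal a)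
    (ae_of_all _ fun _ => (Real.exp_pos _).le)]
  have h := congrFun (mgf_fun_id_gaussianReal (μ := 0) (v := v)) a
  rw [mgf] at h
  rw [h, zero_mul, zero_add]

theorem lintegral_exp_sum_pi_gaussianReal {ι : Type*} [Fintype ι] (v : ℝ≥0) (a : ι → ℝ) :
    ∫⁻ w, ENNReal.ofReal (Real.exp (∑ i, a i * w i)) ∂Measure.pi (fun _ : ι => gaussianReal 0 v)
      = ENNReal.ofReal (Real.exp (∑ i, v * a i ^ 2 / 2)) := by
  simp_rw [ofReal_exp_sum]
  rw [lintegral_pi_prod (fun _ : ι => gaussianReal 0 v)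
    (f := fun i t => ENNReal.ofReal (Real.exp (a i * t))) fun i => by fun_prop]
  simp_rw [lintegral_exp_mul_gaussianReal]

/-- The Gaussian chi-square moment generating function. -/
theorem lintegral_exp_sq_gaussianReal {v : ℝ≥0} (hv : v ≠ 0) {t : ℝ} (ht : t < 1 / 2) :
    ∫⁻ x, ENNReal.ofReal (Real.exp (t * (x ^ 2 / v))) ∂gaussianReal 0 v
      = ENNReal.ofReal (√(1 - 2 * t))⁻¹ := by
  have hv0 : (0 : ℝ) < v := by positivity
  have hb : 0 < (1 - 2 * t) / (2 * v) := div_pos (by linarith) (by positivity)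
  rw [gaussianReal_of_var_ne_zero _ hv, lintegral_withDensity_eq_lintegral_mul _
    (measurable_gaussianPDF 0 v) (by fun_prop)]
  have h (x : ℝ) : (gaussianPDF 0 v * fun x => ENNReal.ofReal (Real.exp (t * (x ^ 2 / v)))) x
      = ENNReal.ofReal ((√(2 * Real.pi * v))⁻¹ *
        Real.exp (-((1 - 2 * t) / (2 * v)) * x ^ 2)) := by
    rw [Pi.mul_apply, gaussianPDF, ← ENNReal.ofReal_mul (gaussianPDFReal_nonneg _ _ _),
      gaussianPDFReal, mul_assoc, ← Real.exp_add]
    congr 3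
    field_simp
    ring
  simp_rw [h]
  rw [← ofReal_integral_eq_lintegral_ofReal ((integrable_exp_neg_mul_sq hb).const_mul _)
    (ae_of_all _ fun _ => by positivity), integral_const_mul, integral_gaussian,
    ← Real.sqrt_inv, ← Real.sqrt_inv, ← Real.sqrt_mul (by positivity)]
  congr 2
  have : 1 - 2 * t ≠ 0 := by linarith
  field_simp

/-- The likelihood ratio of the Gaussian product measure shifted by `s` with respect to the
centered one of variance `v`. -/
noncomputable def gaussLR {ι : Type*} [Fintype ι] (v : ℝ≥0) (s w : ι → ℝ) : ℝ≥0∞ :=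
  ENNReal.ofReal (Real.exp (∑ i, (s i * w i / v - s i ^ 2 / (2 * v))))

theorem measurable_uncurry_gaussLR {X ι : Type*} [MeasurableSpace X] [Fintype ι] (v : ℝ≥0)
    {s : X → ι → ℝ} (hs : Measurable s) :
    Measurable (Function.uncurry fun x w => gaussLR v (s x) w) := by
  unfold Function.uncurry gaussLR
  fun_prop

theorem withDensity_gaussianReal {v : ℝ≥0} (hv : v ≠ 0) (m : ℝ) :
    (gaussianReal 0 v).withDensity
      (fun t => ENNReal.ofReal (Real.exp (m * t / v - m ^ 2 / (2 * v)))) = gaussianReal m v := by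
  have hv0 : (0 : ℝ) < v := by positivity
  rw [gaussianReal_of_var_ne_zero _ hv, gaussianReal_of_var_ne_zero _ hv,
    ← withDensity_mul _ (measurable_gaussianPDF 0 v) (by fun_prop)]
  congr 1
  ext x
  rw [Pi.mul_apply, gaussianPDF, gaussianPDF, ← ENNReal.ofReal_mul (gaussianPDFReal_nonneg _ _ _),
    gaussianPDFReal, gaussianPDFReal, mul_assoc, ← Real.exp_add]
  congr 3
  field_simp
  ring

theorem pi_gaussianReal_withDensity {ι : Type*} [Fintype ι] {v : ℝ≥0} (hv : v ≠ 0) (s : ι → ℝ) :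
    Measure.pi (fun i => gaussianReal (s i) v)
      = (Measure.pi fun _ : ι => gaussianReal 0 v).withDensity (gaussLR v s) := by
  refine Measure.pi_eq fun S hS => ?_
  rw [withDensity_apply _ (MeasurableSet.univ_pi hS), ← lintegral_indicator
    (MeasurableSet.univ_pi hS)]
  have h (w : ι → ℝ) : (Set.univ.pi S).indicator (gaussLR v s) w
      = ∏ i, (S i).indicator
        (fun t => ENNReal.ofReal (Real.exp (s i * t / v - s i ^ 2 / (2 * v)))) (w i) := by
    by_cases hw : w ∈ Set.univ.pi S
    · rw [Set.indicator_of_mem hw, gaussLR, ofReal_exp_sum]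
      exact Finset.prod_congr rfl fun i _ => by
        rw [Set.indicator_of_mem (hw i (Set.mem_univ i))]
    · rw [Set.indicator_of_notMem hw]
      simp only [Set.mem_pi, Set.mem_univ, true_imp_iff, not_forall] at hw
      obtain ⟨i, hi⟩ := hw
      exact (Finset.prod_eq_zero (Finset.mem_univ i) (Set.indicator_of_notMem hi _)).symm
  simp_rw [h]
  rw [lintegral_pi_prod (fun _ : ι => gaussianReal 0 v) fun i =>
    Measurable.indicator (by fun_prop) (hS i)]
  refine Finset.prod_congr rfl fun i _ => ?_
  rw [lintegral_indicator (hS i), ← withDensity_apply _ (hS i), withDensity_gaussianReal hv]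

theorem pi_gaussianReal_preimage_add {ι : Type*} [Fintype ι] {v : ℝ≥0} (hv : v ≠ 0) (s : ι → ℝ)
    {A : Set (ι → ℝ)} (hA : MeasurableSet A) :
    Measure.pi (fun _ : ι => gaussianReal 0 v) ((fun w i => s i + w i) ⁻¹' A)
      = ∫⁻ w in A, gaussLR v s w ∂Measure.pi (fun _ : ι => gaussianReal 0 v) := by
  have : ∀ i, SigmaFinite ((gaussianReal 0 v).map fun t => s i + t) := fun i => by
    rw [gaussianReal_map_const_add]; infer_instance
  rw [← withDensity_apply _ hA, ← pi_gaussianReal_withDensity hv,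
    ← Measure.map_apply (by fun_prop) hA,
    Measure.pi_map_pi (f := fun i t => s i + t) fun i => by fun_prop]
  simp_rw [gaussianReal_map_const_add, zero_add]

theorem lintegral_gaussLR_mul {ι : Type*} [Fintype ι] {v : ℝ≥0} (hv : v ≠ 0) (s t : ι → ℝ) :
    ∫⁻ w, gaussLR v s w * gaussLR v t w ∂Measure.pi (fun _ : ι => gaussianReal 0 v)
      = ENNReal.ofReal (Real.exp (∑ i, s i * t i / v)) := by
  have hv0 : (0 : ℝ) < v := by positivity
  have h (w : ι → ℝ) : gaussLR v s w * gaussLR v t w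
      = ENNReal.ofReal (Real.exp (∑ i, (-(s i ^ 2 + t i ^ 2) / (2 * v)))) *
        ENNReal.ofReal (Real.exp (∑ i, ((s i + t i) / v) * w i)) := by
    rw [gaussLR, gaussLR, ← ENNReal.ofReal_mul (Real.exp_pos _).le,
      ← ENNReal.ofReal_mul (Real.exp_pos _).le, ← Real.exp_add, ← Real.exp_add,
      ← Finset.sum_add_distrib, ← Finset.sum_add_distrib]
    congr 3 with i
    field_simp
    ring
  simp_rw [h]
  rw [lintegral_const_mul _ (by fun_prop), lintegral_exp_sum_pi_gaussianReal,
    ← ENNReal.ofReal_mul (Real.exp_pos _).le, ← Real.exp_add, ← Finset.sum_add_distrib]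
  congr 3 with i
  field_simp
  ring

/-- The second moment method: Cauchy-Schwarz for a mixture of densities. -/
theorem lintegral_setLIntegral_le_sqrt {X Ω : Type*} [MeasurableSpace X] [MeasurableSpace Ω]
    (ν : Measure X) (μ : Measure Ω) [SFinite ν] [SFinite μ] {K : X → Ω → ℝ≥0∞}
    (hK : Measurable (Function.uncurry K)) {A : Set Ω} (hA : MeasurableSet A) :
    ∫⁻ x, ∫⁻ w in A, K x w ∂μ ∂ν
      ≤ (∫⁻ y, ∫⁻ x, ∫⁻ w, K x w * K y w ∂μ ∂ν ∂ν) ^ (1 / 2 : ℝ) * μ A ^ (1 / 2 : ℝ) := by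
  have hKx (x : X) : Measurable (K x) := hK.of_uncurry_left
  have hKw (w : Ω) : Measurable fun x => K x w := hK.of_uncurry_right
  have hM : Measurable fun w => ∫⁻ x, K x w ∂ν :=
    Measurable.lintegral_prod_left' (f := Function.uncurry K) hK
  have hsq : ∫⁻ w, (∫⁻ x, K x w ∂ν) ^ (2 : ℝ) ∂μ
      = ∫⁻ y, ∫⁻ x, ∫⁻ w, K x w * K y w ∂μ ∂ν ∂ν := by
    have h (w : Ω) : (∫⁻ x, K x w ∂ν) ^ (2 : ℝ) = ∫⁻ y, ∫⁻ x, K x w * K y w ∂ν ∂ν := by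
      simp_rw [lintegral_mul_const _ (hKw w)]
      rw [lintegral_const_mul _ (hKw w), ENNReal.rpow_two, sq]
    simp_rw [h]
    have hK3 : Measurable fun p : (Ω × X) × X => K p.2 p.1.1 * K p.1.2 p.1.1 :=
      (hK.comp (by fun_prop : Measurable fun p : (Ω × X) × X => (p.2, p.1.1))).mul
        (hK.comp (by fun_prop : Measurable fun p : (Ω × X) × X => (p.1.2, p.1.1)))
    rw [lintegral_lintegral_swap (hK3.lintegral_prod_right').aemeasurable]
    refine lintegral_congr fun y => ?_
    rw [lintegral_lintegral_swap]
    exact (hK3.comp (by fun_prop : Measurable fun p : Ω × X => ((p.1, y), p.2))).aemeasurable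
  rw [lintegral_lintegral_swap hK.aemeasurable, ← lintegral_indicator hA, ← hsq]
  have hcs := ENNReal.lintegral_mul_le_Lp_mul_Lq μ Real.HolderConjugate.two_two
    hM.aemeasurable
    (measurable_one.indicator hA : Measurable (A.indicator (1 : Ω → ℝ≥0∞))).aemeasurable
  convert hcs using 2
  · ext w
    by_cases hw : w ∈ A <;> simp [hw]
  · congr 1
    rw [← lintegral_indicator_one hA]
    refine lintegral_congr fun w => ?_
    by_cases hw : w ∈ A <;> simp [hw]

/-- The exponential moment of the squared overlap of a Gaussian vector with a fixed vector,
by linearizing the square with an auxiliary standard Gaussian. -/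
theorem lintegral_exp_sq_inner_le {ι : Type*} [Fintype ι] (v : ℝ≥0) {c r : ℝ} (hc : 0 ≤ c)
    (hr : c * v * r < 1) {y : ι → ℝ} (hy : ∑ i, y i ^ 2 ≤ r) :
    ∫⁻ x, ENNReal.ofReal (Real.exp (c * (∑ i, x i * y i) ^ 2 / 2))
        ∂Measure.pi (fun _ : ι => gaussianReal 0 v)
      ≤ ENNReal.ofReal (√(1 - c * v * r))⁻¹ := by
  have h (x : ι → ℝ) : ENNReal.ofReal (Real.exp (c * (∑ i, x i * y i) ^ 2 / 2))
      = ∫⁻ g, ENNReal.ofReal (Real.exp (∑ i, (√c * g * y i) * x i)) ∂gaussianReal 0 1 := by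
    have := lintegral_exp_mul_gaussianReal 1 (√c * ∑ i, x i * y i)
    rw [mul_pow, Real.sq_sqrt hc, NNReal.coe_one, one_mul] at this
    rw [← this]
    refine lintegral_congr fun g => ?_
    rw [Finset.mul_sum, Finset.sum_mul]
    congr 3 with i
    ring
  simp_rw [h]
  rw [lintegral_lintegral_swap (Measurable.aemeasurable (by unfold Function.uncurry; fun_prop))]
  simp_rw [lintegral_exp_sum_pi_gaussianReal]
  have hg := lintegral_exp_sq_gaussianReal one_ne_zero (t := c * v * r / 2) (by linarith)
  rw [mul_div_cancel₀ _ two_ne_zero] at hg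
  rw [← hg]
  refine lintegral_mono fun g => ENNReal.ofReal_le_ofReal (Real.exp_le_exp.2 ?_)
  calc ∑ i, (v : ℝ) * (√c * g * y i) ^ 2 / 2 = (c * v * g ^ 2 / 2) * ∑ i, y i ^ 2 := by
        rw [Finset.mul_sum]
        refine Finset.sum_congr rfl fun i _ => ?_
        rw [mul_pow, mul_pow, Real.sq_sqrt hc]
        ring
    _ ≤ (c * v * g ^ 2 / 2) * r := mul_le_mul_of_nonneg_left hy (by positivity)
    _ = c * v * r / 2 * (g ^ 2 / ((1 : ℝ≥0) : ℝ)) := by simp; ring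

/-- Chernoff bound for the squared norm of the Gaussian spike. -/
theorem gaussPrior_norm_sq_gt_le {n : ℕ} (hn : n ≠ 0) {r : ℝ} (hr : 1 < r) :
    gaussPrior n {x | ∑ i, x i ^ 2 ≤ r}ᶜ
      ≤ ENNReal.ofReal (Real.exp (-((r - 1) / 2)) * √r) ^ n := by
  have hr0 : 0 < r := by linarith
  have hv : ((n : ℝ≥0))⁻¹ ≠ 0 := by positivity
  set t : ℝ := (1 - r⁻¹) / 2 with ht
  have ht0 : 0 ≤ t := by
    have := inv_lt_one_of_one_lt₀ hr
    rw [ht]; linarith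
  have ht1 : t < 1 / 2 := by
    have := inv_pos.2 hr0
    rw [ht]; linarith
  calc gaussPrior n {x | ∑ i, x i ^ 2 ≤ r}ᶜ
      ≤ ∫⁻ x, ∏ i, ENNReal.ofReal (Real.exp (-(t * r)) *
          Real.exp (t * (x i ^ 2 / ((n : ℝ≥0)⁻¹ : ℝ≥0)))) ∂gaussPrior n := by
        refine meas_le_lintegral₀ (Measurable.aemeasurable (by fun_prop)) fun x hx => ?_
        simp only [Set.mem_compl_iff, Set.mem_ofPred_eq, not_le] at hx
        simp_rw [← Real.exp_add]
        rw [← ofReal_exp_sum, ENNReal.one_le_ofReal, Real.one_le_exp_iff]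
        have : ∑ i, (-(t * r) + t * (x i ^ 2 / (((n : ℝ≥0)⁻¹ : ℝ≥0) : ℝ)))
            = n * t * (∑ i, x i ^ 2 - r) := by
          rw [Finset.sum_add_distrib, ← Finset.mul_sum, ← Finset.sum_div]
          simp
          ring
        rw [this]
        exact mul_nonneg (by positivity) (by linarith)
    _ = ENNReal.ofReal (Real.exp (-((r - 1) / 2)) * √r) ^ n := by
        rw [gaussPrior, lintegral_pi_prod (fun _ : Fin n => gaussianReal 0 (n : ℝ≥0)⁻¹)
          (f := fun _ s => ENNReal.ofReal (Real.exp (-(t * r)) *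
            Real.exp (t * (s ^ 2 / ((n : ℝ≥0)⁻¹ : ℝ≥0))))) fun i => by fun_prop]
        rw [Finset.prod_const, Finset.card_univ, Fintype.card_fin]
        congr 1
        simp_rw [ENNReal.ofReal_mul (Real.exp_pos _).le]
        rw [lintegral_const_mul _ (by fun_prop), lintegral_exp_sq_gaussianReal hv ht1]
        have h1 : t * r = (r - 1) / 2 := by rw [ht]; field_simp
        have h2 : 1 - 2 * t = r⁻¹ := by rw [ht]; ring
        rw [h1, h2, Real.sqrt_inv, inv_inv]

theorem tendsto_gaussPrior_norm_sq_gt {r : ℝ} (hr : 1 < r) :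
    Tendsto (fun n => gaussPrior n {x | ∑ i, x i ^ 2 ≤ r}ᶜ) atTop (𝓝 0) := by
  have hlt : ENNReal.ofReal (Real.exp (-((r - 1) / 2)) * √r) < 1 := by
    rw [ENNReal.ofReal_lt_one, Real.exp_neg, inv_mul_lt_one₀ (Real.exp_pos _),
      Real.sqrt_lt' (Real.exp_pos _), ← Real.exp_nat_mul]
    have := Real.add_one_lt_exp (x := r - 1) (by linarith)
    have h2 : ((2 : ℕ) : ℝ) * ((r - 1) / 2) = r - 1 := by push_cast; ring
    rw [h2]
    linarith
  refine tendsto_of_tendsto_of_tendsto_of_le_of_le' tendsto_const_nhds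
    (ENNReal.tendsto_pow_atTop_nhds_zero_of_lt_one hlt) (Eventually.of_forall fun _ => zero_le) ?_
  filter_upwards [eventually_ne_atTop 0] with n hn using gaussPrior_norm_sq_gt_le hn hr

instance isProbabilityMeasure_gaussPrior (n : ℕ) : IsProbabilityMeasure (gaussPrior n) := by
  unfold gaussPrior; infer_instance

instance isProbabilityMeasure_gwigUnspiked (n : ℕ) : IsProbabilityMeasure (gwigUnspiked n) := by
  unfold gwigUnspiked
  exact Measure.isProbabilityMeasure_map (by fun_prop)

theorem lintegral_exp_sq_inner_gaussPrior_le {n : ℕ} (hn : n ≠ 0) {lam r : ℝ}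
    (hr : lam ^ 2 * r < 1) {y : Fin n → ℝ} (hy : ∑ i, y i ^ 2 ≤ r) :
    ∫⁻ x, ENNReal.ofReal (Real.exp (n * lam ^ 2 * (∑ i, x i * y i) ^ 2 / 2)) ∂gaussPrior n
      ≤ ENNReal.ofReal (√(1 - lam ^ 2 * r))⁻¹ := by
  have hnv : n * lam ^ 2 * (((n : ℝ≥0)⁻¹ : ℝ≥0) : ℝ) * r = lam ^ 2 * r := by
    push_cast
    field_simp
  have := lintegral_exp_sq_inner_le (n : ℝ≥0)⁻¹ (c := n * lam ^ 2) (by positivity)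
    (hnv ▸ hr) hy
  rwa [hnv] at this

/-- The correlation of the likelihood ratios of two rank-one spikes. -/
theorem lintegral_gaussLR_mul_rankOne {n : ℕ} (hn : n ≠ 0) (lam : ℝ) (x y : Fin n → ℝ) :
    ∫⁻ w, gaussLR (1 / (2 * (n : ℝ≥0))) (fun p : Fin n × Fin n => lam / 2 * (x p.1 * x p.2)) w
        * gaussLR (1 / (2 * (n : ℝ≥0))) (fun p => lam / 2 * (y p.1 * y p.2)) w
        ∂Measure.pi (fun _ => gaussianReal 0 (1 / (2 * (n : ℝ≥0))))
      = ENNReal.ofReal (Real.exp (n * lam ^ 2 * (∑ i, x i * y i) ^ 2 / 2)) := by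
  rw [lintegral_gaussLR_mul (by positivity)]
  congr 2
  rw [sq (∑ i, x i * y i), Finset.sum_mul_sum, Fintype.sum_prod_type, Finset.mul_sum,
    Finset.sum_div]
  refine Finset.sum_congr rfl fun i _ => ?_
  rw [Finset.mul_sum, Finset.sum_div]
  refine Finset.sum_congr rfl fun j _ => ?_
  push_cast
  field_simp

theorem gwigUnspiked_map_rankOne_apply {n : ℕ} (hn : n ≠ 0) (lam : ℝ) (x : Fin n → ℝ)
    {A : Set (Fin n → Fin n → ℝ)} (hA : MeasurableSet A) :
    (gwigUnspiked n).map (fun Y i j => lam * (x i * x j) + Y i j) A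
      = ∫⁻ w in (fun (W : Fin n × Fin n → ℝ) i j => W (i, j) + W (j, i)) ⁻¹' A,
        gaussLR (1 / (2 * (n : ℝ≥0))) (fun p : Fin n × Fin n => lam / 2 * (x p.1 * x p.2)) w
        ∂Measure.pi (fun _ => gaussianReal 0 (1 / (2 * (n : ℝ≥0)))) := by
  have hΦ : Measurable fun (W : Fin n × Fin n → ℝ) (i j : Fin n) => W (i, j) + W (j, i) := by
    fun_prop
  rw [← pi_gaussianReal_preimage_add (by positivity) _ (hΦ hA), Measure.map_apply (by fun_prop) hA,
    gwigUnspiked, Measure.map_apply hΦ ((by fun_prop : Measurable _) hA)]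
  congr 1
  ext W
  simp only [Set.mem_preimage]
  refine iff_of_eq (congrArg (· ∈ A) ?_)
  funext i j
  ring

/-- The truncated second moment bound. -/
theorem gwigSpiked_le {n : ℕ} (hn : n ≠ 0) {lam r : ℝ} (hr : lam ^ 2 * r < 1)
    {A : Set (Fin n → Fin n → ℝ)} (hA : MeasurableSet A) :
    gwigSpiked n lam (gaussPrior n) A
      ≤ ENNReal.ofReal (√(1 - lam ^ 2 * r))⁻¹ ^ (1 / 2 : ℝ) * gwigUnspiked n A ^ (1 / 2 : ℝ)
        + gaussPrior n {x | ∑ i, x i ^ 2 ≤ r}ᶜ := by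
  set v : ℝ≥0 := 1 / (2 * (n : ℝ≥0))
  set μ : Measure (Fin n × Fin n → ℝ) := Measure.pi fun _ => gaussianReal 0 v
  set Φ : (Fin n × Fin n → ℝ) → Fin n → Fin n → ℝ := fun W i j => W (i, j) + W (j, i)
  have hΦ : Measurable Φ := by fun_prop
  set s : (Fin n → ℝ) → Fin n × Fin n → ℝ := fun x p => lam / 2 * (x p.1 * x p.2)
  have hs : Measurable s := by fun_prop
  set B : Set (Fin n → ℝ) := {x | ∑ i, x i ^ 2 ≤ r}
  have hB : MeasurableSet B := measurableSet_le (by fun_prop) measurable_const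
  have hker (x : Fin n → ℝ) :
      (gwigUnspiked n).map (fun Y i j => lam * (x i * x j) + Y i j) A
        = ∫⁻ w in Φ ⁻¹' A, gaussLR v (s x) w ∂μ :=
    gwigUnspiked_map_rankOne_apply hn lam x hA
  have hmom (x y : Fin n → ℝ) : ∫⁻ w, gaussLR v (s x) w * gaussLR v (s y) w ∂μ
      = ENNReal.ofReal (Real.exp (n * lam ^ 2 * (∑ i, x i * y i) ^ 2 / 2)) :=
    lintegral_gaussLR_mul_rankOne hn lam x y
  have hK : Measurable (Function.uncurry fun x w => gaussLR v (s x) w) :=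
    measurable_uncurry_gaussLR v hs
  have hin : ∫⁻ x in B, ∫⁻ w in Φ ⁻¹' A, gaussLR v (s x) w ∂μ ∂gaussPrior n
      ≤ ENNReal.ofReal (√(1 - lam ^ 2 * r))⁻¹ ^ (1 / 2 : ℝ) *
        gwigUnspiked n A ^ (1 / 2 : ℝ) := by
    have hbound (y) (hy : y ∈ B) : ∫⁻ x in B, ∫⁻ w, gaussLR v (s x) w * gaussLR v (s y) w ∂μ
        ∂gaussPrior n ≤ ENNReal.ofReal (√(1 - lam ^ 2 * r))⁻¹ := by
      simp_rw [hmom]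
      exact (setLIntegral_le_lintegral _ _).trans (lintegral_exp_sq_inner_gaussPrior_le hn hr hy)
    have hA' : gwigUnspiked n A = μ (Φ ⁻¹' A) := Measure.map_apply hΦ hA
    rw [hA']
    refine (lintegral_setLIntegral_le_sqrt ((gaussPrior n).restrict B) μ hK (hΦ hA)).trans ?_
    refine mul_le_mul' (ENNReal.rpow_le_rpow ?_ (by norm_num)) le_rfl
    refine (setLIntegral_mono measurable_const hbound).trans ?_
    rw [lintegral_const, Measure.restrict_apply_univ]
    exact mul_le_of_le_one_right' prob_le_one
  have hout : ∫⁻ x in Bᶜ, (gwigUnspiked n).map (fun Y i j => lam * (x i * x j) + Y i j) A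
      ∂gaussPrior n ≤ gaussPrior n Bᶜ := by
    rw [← setLIntegral_one]
    refine lintegral_mono fun x => ?_
    have hf : Measurable fun (Y : Fin n → Fin n → ℝ) i j => lam * (x i * x j) + Y i j := by
      fun_prop
    have := Measure.isProbabilityMeasure_map (μ := gwigUnspiked n) hf.aemeasurable
    exact prob_le_one
  refine (Measure.bind_apply_le _ hA).trans ?_
  rw [← lintegral_add_compl _ hB]
  refine add_le_add ?_ hout
  simp_rw [hker]
  exact hin

/-- For the i.i.d. Gaussian prior and any `0 ≤ λ < 1`, the spiked Gaussian Wigner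
sequence is contiguous to the unspiked sequence. -/
theorem stmt_9 (lam : ℝ) (hlam0 : 0 ≤ lam) (hlam1 : lam < 1) :
    Contiguous (fun n => gwigSpiked n lam (gaussPrior n)) (fun n => gwigUnspiked n) := by
  intro A hA hQ
  set r : ℝ := 2 / (1 + lam ^ 2) with hrdef
  have hl : lam ^ 2 < 1 := by nlinarith
  have hr1 : 1 < r := by rw [hrdef, lt_div_iff₀ (by positivity)]; linarith
  have hr : lam ^ 2 * r < 1 := by
    rw [hrdef, ← mul_div_assoc, div_lt_one (by positivity)]; linarith
  have hlim : Tendsto (fun n => ENNReal.ofReal (√(1 - lam ^ 2 * r))⁻¹ ^ (1 / 2 : ℝ)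
      * gwigUnspiked n (A n) ^ (1 / 2 : ℝ) + gaussPrior n {x | ∑ i, x i ^ 2 ≤ r}ᶜ)
      atTop (𝓝 0) := by
    have hsqrt : Tendsto (fun n => gwigUnspiked n (A n) ^ (1 / 2 : ℝ)) atTop (𝓝 0) := by
      simpa using hQ.ennrpow_const (1 / 2 : ℝ)
    simpa using (ENNReal.Tendsto.const_mul hsqrt (Or.inr (by finiteness))).add
      (tendsto_gaussPrior_norm_sq_gt hr1)
  refine tendsto_of_tendsto_of_tendsto_of_le_of_le' tendsto_const_nhds hlim
    (Eventually.of_forall fun _ => zero_le) ?_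
  filter_upwards [eventually_ne_atTop 0] with n hn using gwigSpiked_le hn hr (hA n)
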